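/- In the setting of part (1) of Yang–Stufken's complete class theorem, suppose additionally that k is odd and that the index of ξ satisfies I(ξ) ≥ k/2. Then the improving design ξ⁺ can be chosen to have at most (k+1)/2 support points, with B a support point of ξ⁺; that is, there exists a finitely supported probability measure ξ⁺ on [A,B] with at most (k+1)/2 support points, B ∈ supp(ξ⁺), ∫_A^B Ψ_i dξ⁺ = ∫_A^B Ψ_i dξ for all i = 0,…,k−1, and ∫_A^B C₂₂ dξ⁺ − ∫_A^B C₂₂ dξ positive semidefinite. -/

import Mathlib

open MeasureTheory Set Matrix

/-- A family of functions `Ψ₀, …, Ψ_{k-1}` is a Chebyshev system on `[A,B]` if for all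
points `A ≤ x₀ < x₁ < ⋯ < x_{k-1} ≤ B` the matrix `(Ψ i (x j))` has positive determinant. -/
def IsChebyshevSystem (A B : ℝ) {k : ℕ} (Ψ : Fin k → ℝ → ℝ) : Prop :=
  ∀ x : Fin k → ℝ, StrictMono x → (∀ j, x j ∈ Set.Icc A B) →
    0 < (Matrix.of fun i j : Fin k => Ψ i (x j)).det

/-- `ξ` is a design on `[A,B]`: a finitely supported probability measure
`ξ = ∑_{x ∈ s} w_x δ_x` with support points `s ⊆ [A,B]` and positive weights. -/
def IsDesignOn (A B : ℝ) (ξ : Measure ℝ) (s : Finset ℝ) : Prop :=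
  IsProbabilityMeasure ξ ∧ ↑s ⊆ Set.Icc A B ∧ (∀ x ∈ s, 0 < ξ {x}) ∧
    ξ = ∑ x ∈ s, ξ {x} • Measure.dirac x

/-- The entrywise integral `∫ C₂₂(x) dξ(x)` of a matrix-valued function. -/
noncomputable def matrixIntegral {p₁ : ℕ} (C : ℝ → Matrix (Fin p₁) (Fin p₁) ℝ)
    (ξ : Measure ℝ) : Matrix (Fin p₁) (Fin p₁) ℝ :=
  Matrix.of fun a b => ∫ x, C x a b ∂ξ

open Classical in
/-- The index of a design with support `s` on `[A,B]`: the number of support points in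
the open interval `(A,B)` plus one half times the number of support points among the
endpoints `{A, B}`. -/
noncomputable def designIndex (A B : ℝ) (s : Finset ℝ) : ℝ :=
  ((s.filter fun x => x ∈ Set.Ioo A B).card : ℝ) +
    ((s.filter fun x => x = A ∨ x = B).card : ℝ) / 2

open Finsupp (linearCombination)

/-- The convex hull of a compact set in a finite-dimensional space is compact. -/
theorem isCompact_convexHull_of_finiteDimensional {E : Type*} [NormedAddCommGroup E]
    [NormedSpace ℝ E] [FiniteDimensional ℝ E] {S : Set E} (hS : IsCompact S) :
    IsCompact (convexHull ℝ S) := by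
  rcases S.eq_empty_or_nonempty with rfl | ⟨z₀, hz₀⟩
  · simp
  let N := Module.finrank ℝ E + 1
  have hcomp : IsCompact ((stdSimplex ℝ (Fin N)) ×ˢ (Set.univ.pi fun _ : Fin N => S)) :=
    (isCompact_stdSimplex ℝ (Fin N)).prod (isCompact_univ_pi fun _ => hS)
  have hcont : Continuous fun p : (Fin N → ℝ) × (Fin N → E) => ∑ i, p.1 i • p.2 i := by
    fun_prop
  convert hcomp.image hcont using 1
  ext x
  constructor
  · intro hx
    obtain ⟨ι, _, z, w, hz, hai, hw, hw1, rfl⟩ := eq_pos_convex_span_of_mem_convexHull hx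
    have hcard : Fintype.card ι ≤ Fintype.card (Fin N) := by
      simpa [N] using hai.card_le_finrank_succ.trans
        (Nat.add_le_add_right (Submodule.finrank_le _) 1)
    obtain ⟨e⟩ := Function.Embedding.nonempty_of_card_le hcard
    refine ⟨(Function.extend e w (0 : Fin N → ℝ), Function.extend e z fun _ => z₀), ⟨⟨fun j => ?_, ?_⟩, ?_⟩, ?_⟩
    · by_cases hj : ∃ i, e i = j
      · obtain ⟨i, rfl⟩ := hj
        simpa [e.injective.extend_apply] using (hw i).le
      · simp [Function.extend_apply' _ _ _ hj]
    · rw [← hw1]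
      exact (Fintype.sum_of_injective e e.injective w (Function.extend e w (0 : Fin N → ℝ))
        (fun j hj => Function.extend_apply' w (0 : Fin N → ℝ) j hj)
        fun i => (e.injective.extend_apply w (0 : Fin N → ℝ) i).symm).symm
    · intro j _
      by_cases hj : ∃ i, e i = j
      · obtain ⟨i, rfl⟩ := hj
        simpa [e.injective.extend_apply] using hz ⟨i, rfl⟩
      · simpa [Function.extend_apply' _ _ _ hj] using hz₀
    · refine (Fintype.sum_of_injective e e.injective _ _ (fun j hj => ?_) fun i => ?_).symm
      · have hj' : ¬ ∃ i, e i = j := hj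
        simp [Function.extend_apply' _ _ _ hj']
      · simp [e.injective.extend_apply]
  · rintro ⟨⟨w, z⟩, ⟨hw, hz⟩, rfl⟩
    exact (convex_convexHull ℝ S).sum_mem (fun i _ => hw.1 i) hw.2
      fun i _ => subset_convexHull ℝ S (hz i trivial)

/-- `w` is a finitely supported nonnegative weight on `[A,B]`. -/
structure IsWeightOn (A B : ℝ) (w : ℝ →₀ ℝ) : Prop where
  nonneg : ∀ t, 0 ≤ w t
  mem : ∀ t ∈ w.support, t ∈ Set.Icc A B

/-- Two families of moments of finitely supported weights, indexed by `Ψ`, agree. -/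
def SameMoments {k : ℕ} (Ψ : Fin k → ℝ → ℝ) (w w' : ℝ →₀ ℝ) : Prop :=
  ∀ i, linearCombination ℝ (Ψ i) w = linearCombination ℝ (Ψ i) w'

theorem linearCombination_embDomain_fin {n : ℕ} (x : Fin n ↪ ℝ) (c : Fin n → ℝ) (f : ℝ → ℝ) :
    linearCombination ℝ f (Finsupp.embDomain x (Finsupp.equivFunOnFinite.symm c)) =
      ∑ j, c j * f (x j) := by
  rw [Finsupp.linearCombination_embDomain, Finsupp.linearCombination_apply,
    Finsupp.sum_fintype _ _ (by simp)]
  simp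

theorem IsChebyshevSystem.eq_zero_of_card_le {A B : ℝ} {k : ℕ} {Ψ : Fin k → ℝ → ℝ}
    (hAB : A < B) (hΨ : IsChebyshevSystem A B Ψ) {d : ℝ →₀ ℝ} (hd : ∀ t ∈ d.support, t ∈ Set.Icc A B)
    (hcard : d.support.card ≤ k) (h0 : ∀ i, linearCombination ℝ (Ψ i) d = 0) : d = 0 := by
  classical
  obtain ⟨T, hTsub, hdT, hT⟩ : ∃ T : Finset ℝ, (T : Set ℝ) ⊆ Set.Icc A B ∧ d.support ⊆ T ∧
      T.card = k := by
    have hinf : (Set.Icc A B \ (d.support : Set ℝ)).Infinite :=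
      (Set.Icc_infinite hAB).sdiff d.support.finite_toSet
    obtain ⟨U, hU, hUc⟩ := hinf.exists_subset_card_eq (k - d.support.card)
    refine ⟨d.support ∪ U, ?_, Finset.subset_union_left, ?_⟩
    · intro t ht
      rcases Finset.mem_union.1 (Finset.mem_coe.1 ht) with h | h
      · exact hd t h
      · exact (hU h).1
    · rw [Finset.card_union_of_disjoint, hUc]
      · omega
      · rw [Finset.disjoint_right]
        intro t ht
        exact (hU ht).2
  let x := T.orderEmbOfFin hT
  have hdet := hΨ x x.strictMono fun j => hTsub (T.orderEmbOfFin_mem hT j)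
  have hvec : (fun j => d (x j)) = 0 := by
    refine Matrix.eq_zero_of_mulVec_eq_zero hdet.ne' ?_
    funext i
    have := h0 i
    rw [Finsupp.linearCombination_apply, Finsupp.sum_of_support_subset _ hdT _ (by simp)] at this
    rw [← T.image_orderEmbOfFin_univ hT, Finset.sum_image x.injective.injOn] at this
    simpa [Matrix.mulVec, dotProduct, mul_comm, x] using this
  ext t
  by_contra ht
  have : t ∈ T := hdT (by simpa using ht)
  rw [← T.image_orderEmbOfFin_univ hT] at this
  obtain ⟨j, -, rfl⟩ := Finset.mem_image.1 this
  exact ht (congrFun hvec j)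

/-- The cofactor solution: at `k + 1` ordered points there is a signed weight orthogonal to `Ψ`,
with alternating signs, against which `f` has positive integral. -/
theorem exists_alternating_weights {A B : ℝ} {k : ℕ} {Ψ : Fin k → ℝ → ℝ} {f : ℝ → ℝ}
    (hΨ : IsChebyshevSystem A B Ψ) (hf : IsChebyshevSystem A B (Fin.snoc Ψ f : Fin (k + 1) → ℝ → ℝ))
    {x : Fin (k + 1) → ℝ} (hx : StrictMono x) (hmem : ∀ j, x j ∈ Set.Icc A B) :
    ∃ c : Fin (k + 1) → ℝ, (∀ j : Fin (k + 1), 0 < (-1) ^ (k + (j : ℕ)) * c j) ∧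
      (∀ i, ∑ j, c j * Ψ i (x j) = 0) ∧ 0 < ∑ j, c j * f (x j) := by
  let M : Matrix (Fin (k + 1)) (Fin (k + 1)) ℝ :=
    Matrix.of fun i j => (Fin.snoc Ψ f : Fin (k + 1) → ℝ → ℝ) i (x j)
  have hdet : 0 < M.det := hf x hx hmem
  have hmul : ∀ i, ∑ j, M.adjugate j (Fin.last k) * M i j =
      if i = Fin.last k then M.det else 0 := by
    intro i
    have := congrFun (congrFun M.mul_adjugate i) (Fin.last k)
    simp only [Matrix.mul_apply, Matrix.smul_apply, Matrix.one_apply, smul_eq_mul] at this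
    simpa [mul_comm] using this
  refine ⟨fun j : Fin (k + 1) => M.adjugate j (Fin.last k), fun j => ?_, fun i => ?_, ?_⟩
  · have hminor := hΨ (fun i => x (j.succAbove i)) (hx.comp (Fin.strictMono_succAbove j))
      fun i => hmem _
    have hsub : M.submatrix (Fin.last k).succAbove j.succAbove =
        Matrix.of fun i i' => Ψ i (x (j.succAbove i')) := by
      ext i i'
      simp [M]
    change 0 < (-1) ^ (k + (j : ℕ)) * M.adjugate j (Fin.last k)
    rw [Matrix.adjugate_fin_succ_eq_det_submatrix, hsub, ← mul_assoc, ← pow_add, Fin.val_last,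
      Even.neg_one_pow ⟨_, rfl⟩, one_mul]
    exact hminor
  · simpa [M, Fin.castSucc_ne_last] using hmul i.castSucc
  · have := hmul (Fin.last k)
    simp only [M, Matrix.of_apply, Fin.snoc_last, if_true] at this
    rw [this]
    exact hdet

/-- Points of `[A,B]` ending in `B` whose even-indexed members lie in a prescribed finite set. -/
theorem exists_interlacing {A B : ℝ} {n : ℕ} {T : Finset ℝ} (hT : (T : Set ℝ) ⊆ Set.Ico A B)
    (hcard : n ≤ T.card) {k : ℕ} (hk : k + 1 = 2 * n) :
    ∃ x : Fin (k + 1) → ℝ, StrictMono x ∧ (∀ j, x j ∈ Set.Icc A B) ∧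
      (∀ j : Fin (k + 1), Even (j : ℕ) → x j ∈ T) ∧ x (Fin.last k) = B := by
  obtain ⟨U, hUT, hU⟩ := Finset.exists_subset_card_eq hcard
  let y : ℕ → ℝ := fun i => if h : i < n then U.orderEmbOfFin hU ⟨i, h⟩
    else 2 * B - U.orderEmbOfFin hU ⟨n - 1, by omega⟩
  have hyT : ∀ i, i < n → y i ∈ T := fun i hi => by
    simp only [y, hi, dif_pos]
    exact hUT (U.orderEmbOfFin_mem hU _)
  have hystep : ∀ i, i < n → y i < y (i + 1) := fun i hi => by
    by_cases h : i + 1 < n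
    · simp [y, hi, h]
    · have hlast := (hT (hyT i hi)).2
      obtain rfl : i = n - 1 := by omega
      simp only [y, hi, h, dif_pos, dif_neg, not_false_eq_true] at hlast ⊢
      linarith
  let z : ℕ → ℝ := fun j => if Even j then y (j / 2) else (y (j / 2) + y (j / 2 + 1)) / 2
  have hzlast : z k = B := by
    have h1 : ¬ Even k := by rw [Nat.even_iff]; omega
    have h2 : k / 2 = n - 1 := by omega
    have h3 : n - 1 < n := by omega
    have h4 : ¬ n - 1 + 1 < n := by omega
    simp only [z, h1, if_false, h2, y, h3, h4, dif_pos, dif_neg, not_false_eq_true]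
    ring
  have hmono : StrictMono fun j : Fin (k + 1) => z (j : ℕ) := by
    rw [Fin.strictMono_iff_lt_succ]
    intro j
    have hj := j.isLt
    have hs := hystep (j / 2) (by omega)
    rcases Nat.even_or_odd (j : ℕ) with he | ho
    · have h1 : ¬ Even ((j : ℕ) + 1) := by rw [Nat.even_add_one]; simpa using he
      have h2 : ((j : ℕ) + 1) / 2 = j / 2 := by rw [Nat.even_iff] at he; omega
      simp only [z, Fin.val_castSucc, Fin.val_succ, he, h1, if_true, if_false, h2]
      linarith
    · have h0 : ¬ Even (j : ℕ) := by simpa using ho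
      have h1 : Even ((j : ℕ) + 1) := by rw [Nat.even_add_one]; exact h0
      have h2 : ((j : ℕ) + 1) / 2 = j / 2 + 1 := by rw [Nat.even_iff] at h0; omega
      simp only [z, Fin.val_castSucc, Fin.val_succ, h0, h1, if_true, if_false, h2]
      linarith
  have heven : ∀ j : Fin (k + 1), Even (j : ℕ) → z (j : ℕ) ∈ T := by
    intro j hj
    have := j.isLt
    simp only [z, hj, if_true]
    exact hyT _ (by omega)
  refine ⟨fun j => z (j : ℕ), hmono, fun j => ⟨?_, ?_⟩, heven, by simpa using hzlast⟩
  · exact (hT (heven 0 (by simp))).1.trans (hmono.monotone (Fin.zero_le j))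
  · exact (hmono.monotone (Fin.le_last j)).trans_eq (by simpa using hzlast)

theorem SameMoments.refl {k : ℕ} (Ψ : Fin k → ℝ → ℝ) (w : ℝ →₀ ℝ) : SameMoments Ψ w w :=
  fun _ => rfl

theorem SameMoments.trans {k : ℕ} {Ψ : Fin k → ℝ → ℝ} {u v w : ℝ →₀ ℝ}
    (huv : SameMoments Ψ u v) (hvw : SameMoments Ψ v w) : SameMoments Ψ u w :=
  fun i => (huv i).trans (hvw i)

theorem SameMoments.symm {k : ℕ} {Ψ : Fin k → ℝ → ℝ} {u v : ℝ →₀ ℝ}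
    (h : SameMoments Ψ u v) : SameMoments Ψ v u :=
  fun i => (h i).symm

theorem IsWeightOn.add {A B : ℝ} {u v : ℝ →₀ ℝ} (hu : IsWeightOn A B u) (hv : IsWeightOn A B v) :
    IsWeightOn A B (u + v) where
  nonneg t := add_nonneg (hu.nonneg t) (hv.nonneg t)
  mem t ht := by
    classical
    rcases Finset.mem_union.1 (Finsupp.support_add ht) with h | h
    exacts [hu.mem t h, hv.mem t h]

theorem IsWeightOn.smul {A B a : ℝ} {u : ℝ →₀ ℝ} (hu : IsWeightOn A B u) (ha : 0 ≤ a) :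
    IsWeightOn A B (a • u) where
  nonneg t := mul_nonneg ha (hu.nonneg t)
  mem t ht := hu.mem t (Finsupp.support_smul ht)

theorem IsWeightOn.single {A B t a : ℝ} (ht : t ∈ Set.Icc A B) (ha : 0 ≤ a) :
    IsWeightOn A B (Finsupp.single t a) where
  nonneg s := by
    classical
    rw [Finsupp.single_apply]
    split_ifs <;> simp [ha]
  mem s hs := by
    obtain rfl := Finset.mem_singleton.1 (Finsupp.support_single_subset hs)
    exact ht

theorem IsWeightOn.erase {A B : ℝ} {u : ℝ →₀ ℝ} (hu : IsWeightOn A B u) (s : ℝ) :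
    IsWeightOn A B (u.erase s) where
  nonneg t := by
    classical
    rw [Finsupp.erase_apply]
    split_ifs
    exacts [le_rfl, hu.nonneg t]
  mem t ht := by
    classical
    rw [Finsupp.support_erase] at ht
    exact hu.mem t (Finset.mem_of_mem_erase ht)

theorem IsWeightOn.sum {A B : ℝ} {ι : Type*} {s : Finset ι} {u : ι → ℝ →₀ ℝ}
    (hu : ∀ i ∈ s, IsWeightOn A B (u i)) : IsWeightOn A B (∑ i ∈ s, u i) := by
  classical
  induction s using Finset.induction_on with
  | empty => exact ⟨by simp, by simp⟩
  | insert a s ha ih =>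
    rw [Finset.sum_insert ha]
    exact (hu a (by simp)).add (ih fun i hi => hu i (by simp [hi]))

/-- A weight with at least `(k+1)/2` atoms in `[A,B)` can be perturbed, keeping the moments of `Ψ`,
so that the integral of `f` increases and `B` becomes an atom. -/
theorem IsWeightOn.exists_improvement {A B : ℝ} {k n : ℕ} {Ψ : Fin k → ℝ → ℝ} {f : ℝ → ℝ}
    (hk : k + 1 = 2 * n) (hΨ : IsChebyshevSystem A B Ψ)
    (hf : IsChebyshevSystem A B (Fin.snoc Ψ f : Fin (k + 1) → ℝ → ℝ)) {w : ℝ →₀ ℝ}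
    (hw : IsWeightOn A B w) (hcard : n ≤ (w.support.erase B).card) :
    ∃ w', IsWeightOn A B w' ∧ SameMoments Ψ w' w ∧
      linearCombination ℝ f w < linearCombination ℝ f w' ∧ 0 < w' B := by
  classical
  obtain ⟨x, hx, hmem, heven, hlast⟩ := exists_interlacing (A := A) (B := B)
    (T := w.support.erase B) (fun t ht => by
      have ht' := Finset.mem_erase.1 (Finset.mem_coe.1 ht)
      have := hw.mem t ht'.2
      exact ⟨this.1, lt_of_le_of_ne this.2 ht'.1⟩) hcard hk
  obtain ⟨c, hsign, hc0, hcf⟩ := exists_alternating_weights hΨ hf hx hmem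
  have hkodd : Odd k := ⟨n - 1, by omega⟩
  have hpos : ∀ j : Fin (k + 1), ¬ Even (j : ℕ) → 0 < c j := fun j hj => by
    have := hsign j
    rwa [(hkodd.add_odd (by simpa using hj)).neg_one_pow, one_mul] at this
  obtain ⟨ε, hε, hεw⟩ : ∃ ε : ℝ, 0 < ε ∧ ∀ j, 0 ≤ w (x j) + ε * c j := by
    have : ∀ᶠ ε : ℝ in nhdsWithin 0 (Set.Ioi 0), ∀ j, 0 ≤ w (x j) + ε * c j := by
      rw [Filter.eventually_all]
      intro j
      by_cases hj : Even (j : ℕ)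
      · have hwj : 0 < w (x j) := lt_of_le_of_ne (hw.nonneg _)
          (Finsupp.mem_support_iff.1 (Finset.mem_of_mem_erase (heven j hj))).symm
        have hcont : Filter.Tendsto (fun ε : ℝ => w (x j) + ε * c j) (nhdsWithin 0 (Set.Ioi 0))
            (nhds (w (x j) + 0 * c j)) :=
          (Continuous.tendsto (by fun_prop) 0).mono_left nhdsWithin_le_nhds
        exact (hcont.eventually_const_lt (by simpa using hwj)).mono fun _ h => h.le
      · filter_upwards [self_mem_nhdsWithin] with ε hε
        exact add_nonneg (hw.nonneg _) (mul_pos hε (hpos j hj)).le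
    obtain ⟨ε, h1, h2⟩ := (this.and self_mem_nhdsWithin).exists
    exact ⟨ε, h2, h1⟩
  let xe : Fin (k + 1) ↪ ℝ := ⟨x, hx.injective⟩
  let d : ℝ →₀ ℝ := Finsupp.embDomain xe (Finsupp.equivFunOnFinite.symm c)
  have hd : ∀ j, d (x j) = c j := fun j => Finsupp.embDomain_apply_self xe _ j
  have hd' : ∀ t, t ∉ Set.range x → d t = 0 := fun t ht => Finsupp.embDomain_of_notMem_range xe _ t ht
  refine ⟨w + ε • d, ⟨fun t => ?_, fun t ht => ?_⟩, fun i => ?_, ?_, ?_⟩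
  · by_cases ht : t ∈ Set.range x
    · obtain ⟨j, rfl⟩ := ht
      simpa [hd] using hεw j
    · simpa [hd' t ht] using hw.nonneg t
  · by_cases ht' : t ∈ Set.range x
    · obtain ⟨j, rfl⟩ := ht'
      exact hmem j
    · refine hw.mem t ?_
      simpa [hd' t ht'] using ht
  · rw [map_add, map_smul, linearCombination_embDomain_fin]
    simp [xe, hc0]
  · rw [map_add, map_smul, linearCombination_embDomain_fin]
    simpa [xe] using mul_pos hε hcf
  · have h1 := hpos (Fin.last k) (by simpa using hkodd)
    have h2 := hd (Fin.last k)
    rw [hlast] at h2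
    simp only [Finsupp.add_apply, Finsupp.smul_apply, h2, smul_eq_mul]
    exact add_pos_of_nonneg_of_pos (hw.nonneg B) (mul_pos hε h1)

/-- Points of the convex hull of a curve are moment vectors of probability weights. -/
theorem mem_convexHull_image_Icc_iff {A B : ℝ} {E : Type*} [AddCommGroup E] [Module ℝ E]
    {γ : ℝ → E} {z : E} :
    z ∈ convexHull ℝ (γ '' Set.Icc A B) ↔ ∃ w, IsWeightOn A B w ∧
      linearCombination ℝ (fun _ => (1 : ℝ)) w = 1 ∧ linearCombination ℝ γ w = z := by
  constructor
  · intro hz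
    obtain ⟨ι, _, a, p, ha, ha1, hp, rfl⟩ := mem_convexHull_iff_exists_fintype.1 hz
    choose x hx hxp using hp
    refine ⟨∑ i, Finsupp.single (x i) (a i), .sum fun i _ => .single (hx i) (ha i), ?_, ?_⟩
    · simpa using ha1
    · simp [hxp]
  · rintro ⟨w, hw, h1, rfl⟩
    rw [Finsupp.linearCombination_apply]
    refine (convex_convexHull ℝ _).sum_mem (fun t _ => hw.nonneg t) ?_
      fun t ht => subset_convexHull ℝ _ ⟨t, hw.mem t ht, rfl⟩
    simpa [Finsupp.linearCombination_apply, Finsupp.sum] using h1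

/-- Among probability weights with given moments, the integral of `f` attains its maximum. -/
theorem IsWeightOn.exists_isMax {A B : ℝ} {k : ℕ} {Ψ : Fin k → ℝ → ℝ} {f : ℝ → ℝ}
    (hΨ : ∀ i, ContinuousOn (Ψ i) (Set.Icc A B)) (hf : ContinuousOn f (Set.Icc A B))
    {w : ℝ →₀ ℝ} (hw : IsWeightOn A B w)
    (h1 : linearCombination ℝ (fun _ => (1 : ℝ)) w = 1) :
    ∃ u, IsWeightOn A B u ∧ SameMoments Ψ u w ∧
      ∀ v, IsWeightOn A B v → linearCombination ℝ (fun _ => (1 : ℝ)) v = 1 →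
        SameMoments Ψ v w → linearCombination ℝ f v ≤ linearCombination ℝ f u := by
  let γ : ℝ → (Fin k → ℝ) × ℝ := fun t => (fun i => Ψ i t, f t)
  have hγ : ContinuousOn γ (Set.Icc A B) := (continuousOn_pi.2 hΨ).prodMk hf
  have hfst : ∀ (v : ℝ →₀ ℝ) i, (linearCombination ℝ γ v).1 i = linearCombination ℝ (Ψ i) v :=
    fun v i => by
      simp [Finsupp.linearCombination_apply, Finsupp.sum, γ, Prod.fst_sum]
  have hsnd : ∀ v : ℝ →₀ ℝ, (linearCombination ℝ γ v).2 = linearCombination ℝ f v :=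
    fun v => by
      simp [Finsupp.linearCombination_apply, Finsupp.sum, γ, Prod.snd_sum]
  have hK := isCompact_convexHull_of_finiteDimensional (isCompact_Icc.image_of_continuousOn hγ)
  have hK' := hK.inter_right
    (isClosed_eq continuous_fst (continuous_const (y := (linearCombination ℝ γ w).1)))
  obtain ⟨z, ⟨hz, hzm⟩, hmax⟩ := hK'.exists_isMaxOn
    ⟨_, mem_convexHull_image_Icc_iff.2 ⟨w, hw, h1, rfl⟩, rfl⟩ continuous_snd.continuousOn
  obtain ⟨u, hu, -, rfl⟩ := mem_convexHull_image_Icc_iff.1 hz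
  refine ⟨u, hu, fun i => ?_, fun v hv hv1 hvm => ?_⟩
  · rw [← hfst, ← hfst]
    exact congrFun hzm i
  · rw [← hsnd, ← hsnd]
    refine hmax ⟨mem_convexHull_image_Icc_iff.2 ⟨v, hv, hv1, rfl⟩, ?_⟩
    funext i
    rw [hfst, hfst]
    exact hvm i

/-- Every weight is dominated by one with fewer than `(k+1)/2` atoms in `[A,B)`. -/
theorem IsWeightOn.exists_dominating {A B : ℝ} {k n : ℕ} {Ψ : Fin k → ℝ → ℝ} {f : ℝ → ℝ}
    (hk : k + 1 = 2 * n) (hΨ : IsChebyshevSystem A B Ψ)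
    (hf : IsChebyshevSystem A B (Fin.snoc Ψ f : Fin (k + 1) → ℝ → ℝ))
    (hcontΨ : ∀ i, ContinuousOn (Ψ i) (Set.Icc A B)) (hcontf : ContinuousOn f (Set.Icc A B))
    (hone : ∃ i, Ψ i = fun _ => 1) {w : ℝ →₀ ℝ} (hw : IsWeightOn A B w) :
    ∃ u, IsWeightOn A B u ∧ SameMoments Ψ u w ∧ (u.support.erase B).card < n ∧
      linearCombination ℝ f w ≤ linearCombination ℝ f u := by
  classical
  obtain ⟨i₀, hi₀⟩ := hone
  have hmass : linearCombination ℝ (fun _ => (1 : ℝ)) w = ∑ t ∈ w.support, w t := by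
    simp [Finsupp.linearCombination_apply, Finsupp.sum]
  rcases (Finset.sum_nonneg fun t _ => hw.nonneg t : 0 ≤ ∑ t ∈ w.support, w t).eq_or_lt
    with h0 | hpos
  · have hw0 : w = 0 := by
      ext t
      by_contra ht
      exact ht ((Finset.sum_eq_zero_iff_of_nonneg fun t _ => hw.nonneg t).1 h0.symm t
        (by simpa using ht))
    subst hw0
    exact ⟨0, hw, .refl _ _, by simp; omega, le_rfl⟩
  rw [← hmass] at hpos
  set m := linearCombination ℝ (fun _ => (1 : ℝ)) w with hm
  obtain ⟨u, hu, hum, hmax⟩ := (hw.smul (inv_nonneg.2 hpos.le)).exists_isMax hcontΨ hcontf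
    (by rw [map_smul, ← hm, smul_eq_mul, inv_mul_cancel₀ hpos.ne'])
  have hmoment : ∀ v : ℝ →₀ ℝ, SameMoments Ψ v (m⁻¹ • w) →
      linearCombination ℝ (fun _ => (1 : ℝ)) v = 1 := fun v hv => by
    rw [← hi₀, hv i₀, hi₀, map_smul, ← hm, smul_eq_mul, inv_mul_cancel₀ hpos.ne']
  refine ⟨m • u, hu.smul hpos.le, fun i => ?_, ?_, ?_⟩
  · rw [map_smul, hum i, map_smul, smul_inv_smul₀ hpos.ne']
  · rw [Finsupp.support_smul_eq hpos.ne']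
    by_contra! hcard
    obtain ⟨v, hv, hvm, hlt, -⟩ := hu.exists_improvement hk hΨ hf hcard
    exact hlt.not_ge (hmax v hv (hmoment v (hvm.trans hum)) (hvm.trans hum))
  · have := hmax _ (hw.smul (inv_nonneg.2 hpos.le)) (hmoment _ (.refl _ _)) (.refl _ _)
    rw [map_smul, smul_eq_mul] at this
    rw [map_smul, smul_eq_mul]
    calc linearCombination ℝ f w = m * (m⁻¹ * linearCombination ℝ f w) := by
          rw [mul_inv_cancel_left₀ hpos.ne']
      _ ≤ _ := mul_le_mul_of_nonneg_left this hpos.le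

/-- Weights with fewer than `(k+1)/2` atoms in `[A,B)` are determined by their moments. -/
theorem SameMoments.eq_of_card_lt {A B : ℝ} {k n : ℕ} {Ψ : Fin k → ℝ → ℝ} (hAB : A < B)
    (hk : k + 1 = 2 * n) (hΨ : IsChebyshevSystem A B Ψ) {u v : ℝ →₀ ℝ}
    (huv : SameMoments Ψ u v) (hu : IsWeightOn A B u) (hv : IsWeightOn A B v)
    (hucard : (u.support.erase B).card < n) (hvcard : (v.support.erase B).card < n) : u = v := by
  classical
  have hsub : (u - v).support ⊆ insert B (u.support.erase B ∪ v.support.erase B) := by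
    intro t ht
    by_cases htB : t = B
    · simp [htB]
    · have := Finset.mem_union.1 (Finsupp.support_sub ht)
      simp only [Finset.mem_insert, Finset.mem_union, Finset.mem_erase]
      tauto
  refine sub_eq_zero.1 (hΨ.eq_zero_of_card_le hAB (fun t ht => ?_) ?_ fun i => ?_)
  · rcases Finset.mem_union.1 (Finsupp.support_sub ht) with h | h
    exacts [hu.mem t h, hv.mem t h]
  · have h1 := Finset.card_le_card hsub
    have h2 := Finset.card_insert_le B (u.support.erase B ∪ v.support.erase B)
    have h3 := Finset.card_union_le (u.support.erase B) (v.support.erase B)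
    omega
  · rw [map_sub, huv i, sub_self]

/-- If some weight with the same moments charges `B`, there is one weight with fewer than
`(k+1)/2` further atoms that charges `B`. -/
theorem IsWeightOn.exists_upper {A B : ℝ} {k n : ℕ} {Ψ : Fin k → ℝ → ℝ} {f : ℝ → ℝ}
    (hAB : A < B) (hk : k + 1 = 2 * n) (hΨ : IsChebyshevSystem A B Ψ)
    (hf : IsChebyshevSystem A B (Fin.snoc Ψ f : Fin (k + 1) → ℝ → ℝ))
    (hcontΨ : ∀ i, ContinuousOn (Ψ i) (Set.Icc A B)) (hcontf : ContinuousOn f (Set.Icc A B))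
    (hone : ∃ i, Ψ i = fun _ => 1) {w : ℝ →₀ ℝ} (hw : IsWeightOn A B w)
    (hwB : 0 < w B) :
    ∃ u, IsWeightOn A B u ∧ SameMoments Ψ u w ∧ (u.support.erase B).card < n ∧ 0 < u B := by
  classical
  obtain ⟨v, hv, hvm, hvcard, -⟩ :=
    (hw.erase B).exists_dominating hk hΨ hf hcontΨ hcontf hone
  refine ⟨Finsupp.single B (w B) + v, (IsWeightOn.single ⟨hAB.le, le_rfl⟩ hwB.le).add hv,
    fun i => ?_, ?_, ?_⟩
  · rw [map_add, hvm i, ← map_add, Finsupp.single_add_erase]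
  · refine (Finset.card_le_card fun t ht => ?_).trans_lt hvcard
    simp only [Finset.mem_erase, Finsupp.mem_support_iff, Finsupp.add_apply] at ht ⊢
    refine ⟨ht.1, ?_⟩
    simpa [Finsupp.single_apply, Ne.symm ht.1] using ht.2
  · simpa using add_pos_of_pos_of_nonneg hwB (hv.nonneg B)

theorem integral_sum_smul_dirac (T : Finset ℝ) (a : ℝ → ENNReal) (ha : ∀ t ∈ T, a t ≠ ⊤)
    (g : ℝ → ℝ) :
    ∫ x, g x ∂(∑ t ∈ T, a t • Measure.dirac t) = ∑ t ∈ T, (a t).toReal * g t := by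
  rw [integral_finsetSum_measure fun t ht =>
    (integrable_dirac (by simp)).smul_measure (ha t ht)]
  simp

/-- A design is given by a finitely supported weight. -/
theorem IsDesignOn.exists_weight {A B : ℝ} {ξ : Measure ℝ} {s : Finset ℝ}
    (h : IsDesignOn A B ξ s) :
    ∃ w, IsWeightOn A B w ∧ w.support = s ∧ ∀ g : ℝ → ℝ, ∫ x, g x ∂ξ = linearCombination ℝ g w := by
  classical
  obtain ⟨hprob, hsub, hpos, hξ⟩ := h
  have hreal : ∀ t ∈ s, 0 < (ξ {t}).toReal := fun t ht =>
    ENNReal.toReal_pos (hpos t ht).ne' (measure_ne_top ξ _)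
  let w : ℝ →₀ ℝ := Finsupp.onFinset s (fun t => if t ∈ s then (ξ {t}).toReal else 0)
    fun t ht => by by_contra h; simp [h] at ht
  have hw : ∀ t ∈ s, w t = (ξ {t}).toReal := fun t ht => by simp [w, ht]
  have hw' : ∀ t, t ∉ s → w t = 0 := fun t ht => by simp [w, ht]
  have hsupp : w.support = s := by
    ext t
    rw [Finsupp.mem_support_iff]
    by_cases ht : t ∈ s
    · exact iff_of_true ((hw t ht).symm ▸ (hreal t ht).ne') ht
    · simp [hw' t ht, ht]
  refine ⟨w, ⟨fun t => ?_, fun t ht => hsub (by rwa [hsupp] at ht)⟩, hsupp, fun g => ?_⟩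
  · by_cases ht : t ∈ s
    · exact (hw t ht).symm ▸ (hreal t ht).le
    · exact (hw' t ht).ge
  · rw [hξ, integral_sum_smul_dirac s (fun t => ξ {t}) fun t _ => measure_ne_top ξ _,
      Finsupp.linearCombination_apply, Finsupp.sum, hsupp]
    exact Finset.sum_congr rfl fun t ht => by rw [hw t ht, smul_eq_mul]

/-- A finitely supported weight of mass one gives a design. -/
theorem IsWeightOn.exists_design {A B : ℝ} {w : ℝ →₀ ℝ} (hw : IsWeightOn A B w)
    (h1 : linearCombination ℝ (fun _ => (1 : ℝ)) w = 1) :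
    ∃ ξ : Measure ℝ, IsDesignOn A B ξ w.support ∧
      ∀ g : ℝ → ℝ, ∫ x, g x ∂ξ = linearCombination ℝ g w := by
  classical
  let ξ : Measure ℝ := ∑ t ∈ w.support, ENNReal.ofReal (w t) • Measure.dirac t
  have hatom : ∀ t ∈ w.support, ξ {t} = ENNReal.ofReal (w t) := fun t ht => by
    simp only [ξ, Measure.coe_finsetSum, Finset.sum_apply, Measure.smul_apply, smul_eq_mul]
    rw [Finset.sum_eq_single_of_mem t ht fun s _ hs => by simp [hs]]
    simp
  refine ⟨ξ, ⟨⟨?_⟩, fun t ht => hw.mem t ht, fun t ht => ?_, ?_⟩, fun g => ?_⟩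
  · simp only [ξ, Measure.coe_finsetSum, Finset.sum_apply, Measure.smul_apply, smul_eq_mul,
      measure_univ, mul_one]
    rw [← ENNReal.ofReal_sum_of_nonneg fun t _ => hw.nonneg t]
    simpa [Finsupp.linearCombination_apply, Finsupp.sum] using h1
  · rw [hatom t ht, ENNReal.ofReal_pos]
    exact lt_of_le_of_ne (hw.nonneg t) (Finsupp.mem_support_iff.1 ht).symm
  · exact Finset.sum_congr rfl fun t ht => by rw [hatom t ht]
  · rw [integral_sum_smul_dirac _ (fun t => ENNReal.ofReal (w t)) fun t _ => ENNReal.ofReal_ne_top]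
    simp [Finsupp.linearCombination_apply, Finsupp.sum, ENNReal.toReal_ofReal (hw.nonneg _)]

theorem card_ge_of_le_designIndex {A B : ℝ} {s : Finset ℝ} {k n : ℕ} (hk : k + 1 = 2 * n)
    (hidx : (k : ℝ) / 2 ≤ designIndex A B s) : n ≤ s.card := by
  classical
  have hdisj : Disjoint (s.filter fun x => x ∈ Set.Ioo A B) (s.filter fun x => x = A ∨ x = B) := by
    rw [Finset.disjoint_filter]
    rintro x - hx (rfl | rfl)
    exacts [lt_irrefl _ hx.1, lt_irrefl _ hx.2]
  have hle := Finset.card_le_card (Finset.union_subset (Finset.filter_subset _ s)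
    (Finset.filter_subset _ s) :
    (s.filter fun x => x ∈ Set.Ioo A B) ∪ (s.filter fun x => x = A ∨ x = B) ⊆ s)
  rw [Finset.card_union_of_disjoint hdisj] at hle
  have hidx' : (k : ℝ) / 2 ≤ ((s.filter fun x => x ∈ Set.Ioo A B).card : ℝ) +
      ((s.filter fun x => x = A ∨ x = B).card : ℝ) / 2 := by
    unfold designIndex at hidx
    convert hidx
  have hlow : k ≤ 2 * (s.filter fun x => x ∈ Set.Ioo A B).card +
      (s.filter fun x => x = A ∨ x = B).card := by
    have : (k : ℝ) ≤ 2 * ((s.filter fun x => x ∈ Set.Ioo A B).card : ℝ) +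
      ((s.filter fun x => x = A ∨ x = B).card : ℝ) := by linarith
    exact_mod_cast this
  omega

theorem linearCombination_quadratic {p : ℕ} (C : ℝ → Matrix (Fin p) (Fin p) ℝ)
    (Q : Fin p → ℝ) (w : ℝ →₀ ℝ) :
    linearCombination ℝ (fun x => Q ⬝ᵥ (C x *ᵥ Q)) w =
      Q ⬝ᵥ ((Matrix.of fun a b => linearCombination ℝ (fun x => C x a b) w) *ᵥ Q) := by
  simp only [Finsupp.linearCombination_apply, Finsupp.sum, dotProduct, Matrix.mulVec,
    Matrix.of_apply, smul_eq_mul, Finset.mul_sum, Finset.sum_mul]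
  rw [Finset.sum_comm]
  refine Finset.sum_congr rfl fun a _ => ?_
  rw [Finset.sum_comm]
  exact Finset.sum_congr rfl fun b _ => Finset.sum_congr rfl fun t _ => by ring

/-- Yang–Stufken part (1), case (a): in the setting of the complete class theorem with
`k` odd and `I(ξ) ≥ k/2`, the dominating design `ξ⁺` can be chosen with at most
`(k+1)/2` support points, one of which is `B`. -/
theorem complete_class_upper_odd
    {k p₁ : ℕ} (hk : 0 < k) (hp : 1 ≤ p₁) (A B : ℝ) (hAB : A < B)
    (Ψ : Fin k → ℝ → ℝ) (C : ℝ → Matrix (Fin p₁) (Fin p₁) ℝ)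
    (hΨ0 : ∀ x : ℝ, Ψ ⟨0, hk⟩ x = 1)
    (hcontΨ : ∀ i, ContinuousOn (Ψ i) (Set.Icc A B))
    (hcontC : ∀ a b, ContinuousOn (fun x => C x a b) (Set.Icc A B))
    (hsymm : ∀ x ∈ Set.Icc A B, (C x).IsSymm)
    (hCheb : IsChebyshevSystem A B Ψ)
    (hChebQ : ∀ Q : Fin p₁ → ℝ, Q ≠ 0 →
      IsChebyshevSystem A B (Fin.snoc Ψ fun x => Q ⬝ᵥ ((C x) *ᵥ Q)))
    (ξ : Measure ℝ) (s : Finset ℝ) (hξ : IsDesignOn A B ξ s)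
    (hodd : Odd k) (hidx : (k : ℝ) / 2 ≤ designIndex A B s) :
    ∃ (ξp : Measure ℝ) (sp : Finset ℝ), IsDesignOn A B ξp sp ∧
      sp.card ≤ (k + 1) / 2 ∧ B ∈ sp ∧
      (∀ i, ∫ x, Ψ i x ∂ξp = ∫ x, Ψ i x ∂ξ) ∧
      (matrixIntegral C ξp - matrixIntegral C ξ).PosSemidef := by
  classical
  obtain ⟨n, hn⟩ : ∃ n, k + 1 = 2 * n := by
    obtain ⟨m, rfl⟩ := hodd
    exact ⟨m + 1, by ring⟩
  have hone : ∃ i, Ψ i = fun _ => 1 := ⟨_, funext hΨ0⟩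
  have hcontQ : ∀ Q : Fin p₁ → ℝ,
      ContinuousOn (fun x => Q ⬝ᵥ ((C x) *ᵥ Q)) (Set.Icc A B) := fun Q => by
    simp only [dotProduct, Matrix.mulVec]
    fun_prop
  obtain ⟨w, hw, hws, hwint⟩ := hξ.exists_weight
  have hmass : linearCombination ℝ (fun _ => (1 : ℝ)) w = 1 := by
    have := hξ.1
    rw [← hwint]
    simp
  have hQ₁ : (fun _ => 1 : Fin p₁ → ℝ) ≠ 0 := fun h =>
    one_ne_zero (congrFun h ⟨0, hp⟩)
  obtain ⟨w', hw', hw'm, hw'B⟩ : ∃ w', IsWeightOn A B w' ∧ SameMoments Ψ w' w ∧ 0 < w' B := by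
    by_cases hB : B ∈ w.support
    · exact ⟨w, hw, .refl _ _,
        lt_of_le_of_ne (hw.nonneg B) (Finsupp.mem_support_iff.1 hB).symm⟩
    · obtain ⟨w', h1, h2, -, h3⟩ := hw.exists_improvement hn hCheb (hChebQ _ hQ₁) (by
        rw [Finset.erase_eq_of_notMem hB, hws]
        exact card_ge_of_le_designIndex hn hidx)
      exact ⟨w', h1, h2, h3⟩
  obtain ⟨u, hu, hum, hucard, huB⟩ :=
    hw'.exists_upper hAB hn hCheb (hChebQ _ hQ₁) hcontΨ (hcontQ _) hone hw'B
  have huw := hum.trans hw'm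
  have hBmem : B ∈ u.support := Finsupp.mem_support_iff.2 huB.ne'
  obtain ⟨ξp, hξp, huint⟩ := hu.exists_design (by
    obtain ⟨i, hi⟩ := hone
    rw [← hi, huw i, hi, hmass])
  refine ⟨ξp, u.support, hξp, ?_, hBmem, fun i => ?_, ?_⟩
  · rw [Finset.card_erase_of_mem hBmem] at hucard
    omega
  · rw [huint, hwint, huw i]
  · have hquad : ∀ Q : Fin p₁ → ℝ, linearCombination ℝ (fun x => Q ⬝ᵥ ((C x) *ᵥ Q)) w ≤
        linearCombination ℝ (fun x => Q ⬝ᵥ ((C x) *ᵥ Q)) u := fun Q => by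
      by_cases hQ : Q = 0
      · simp [hQ, Finsupp.linearCombination_apply, Finsupp.sum]
      · obtain ⟨v, hv, hvm, hvcard, hle⟩ :=
          hw.exists_dominating hn hCheb (hChebQ Q hQ) hcontΨ (hcontQ Q) hone
        rwa [(huw.trans hvm.symm).eq_of_card_lt hAB hn hCheb hu hv hucard hvcard]
    have hsym : ∀ v, IsWeightOn A B v → ∀ a b, linearCombination ℝ (fun x => C x a b) v =
        linearCombination ℝ (fun x => C x b a) v := fun v hv a b => by
      simp only [Finsupp.linearCombination_apply]
      exact Finset.sum_congr rfl fun t ht =>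
        congrArg (v t • ·) ((hsymm t (hv.mem t ht)).apply b a)
    have hu' : matrixIntegral C ξp =
        Matrix.of fun a b => linearCombination ℝ (fun x => C x a b) u := by
      ext a b
      exact huint _
    have hw'' : matrixIntegral C ξ =
        Matrix.of fun a b => linearCombination ℝ (fun x => C x a b) w := by
      ext a b
      exact hwint _
    rw [hu', hw'']
    refine Matrix.PosSemidef.of_dotProduct_mulVec_nonneg ?_ fun Q => ?_
    · ext a b
      simp [hsym u hu a b, hsym w hw a b]
    · have := hquad Q
      rw [linearCombination_quadratic, linearCombination_quadratic] at this
      rw [star_trivial, Matrix.sub_mulVec, dotProduct_sub]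
      exact sub_nonneg.2 this
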